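/- arXiv:1609.02212 — 4 statements merged into one kernel-verified Lean document; each statement's English description precedes it below -/
import Mathlib

section
/- Let H : ℝⁿ × ℝⁿ → ℝ be continuously differentiable with locally Lipschitz gradient, and let ω ∈ ℝ. Suppose (Q, P) : [0,T] → ℝⁿ × ℝⁿ solves Q̇ = ∂_P H(Q,P), Ṗ = −∂_Q H(Q,P) with (Q(0), P(0)) = (Q₀, P₀), and suppose (q, p, x, y) : [0,T] → ℝ^{4n} solves Hamilton's equations of the extended Hamiltonian H̄ with q(0) = x(0) = Q₀ and p(0) = y(0) = P₀. Then q(t) = x(t) = Q(t) and p(t) = y(t) = P(t) for all t ∈ [0,T]. -/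
open Set

/-- Two solutions on `[a, b]` of an autonomous ODE with locally Lipschitz right-hand side
coincide if they agree at `a`. -/
theorem LocallyLipschitz.eqOn_Icc_of_hasDerivAt {E : Type*} [NormedAddCommGroup E]
    [NormedSpace ℝ E] {v : E → E} (hv : LocallyLipschitz v) {a b : ℝ} {f g : ℝ → E}
    (hf : ∀ t ∈ Icc a b, HasDerivAt f (v (f t)) t)
    (hg : ∀ t ∈ Icc a b, HasDerivAt g (v (g t)) t) (hfg : f a = g a) :
    EqOn f g (Icc a b) := by
  have hfc : ContinuousOn f (Icc a b) := fun t ht => (hf t ht).continuousAt.continuousWithinAt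
  have hgc : ContinuousOn g (Icc a b) := fun t ht => (hg t ht).continuousAt.continuousWithinAt
  obtain ⟨K, hK⟩ := hv.locallyLipschitzOn.exists_lipschitzOnWith_of_compact
    ((isCompact_Icc.image_of_continuousOn hfc).union (isCompact_Icc.image_of_continuousOn hgc))
  exact ODE_solution_unique_of_mem_Icc_right (v := fun _ => v) (fun _ _ => hK)
    hfc (fun t ht => (hf t (Ico_subset_Icc_self ht)).hasDerivWithinAt)
    (fun t ht => .inl (mem_image_of_mem f (Ico_subset_Icc_self ht)))
    hgc (fun t ht => (hg t (Ico_subset_Icc_self ht)).hasDerivWithinAt)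
    (fun t ht => .inr (mem_image_of_mem g (Ico_subset_Icc_self ht))) hfg

/-- The Hamiltonian vector field of the extended Hamiltonian
`H(q,y) + H(x,p) + ω(‖q-x‖² + ‖p-y‖²)/2`, at the point `(q, p, x, y)`. -/
noncomputable def extendedHamiltonianField {n : ℕ} (H : (Fin n → ℝ) × (Fin n → ℝ) → ℝ) (ω : ℝ)
    (z : (Fin n → ℝ) × (Fin n → ℝ) × (Fin n → ℝ) × (Fin n → ℝ)) :
    (Fin n → ℝ) × (Fin n → ℝ) × (Fin n → ℝ) × (Fin n → ℝ) :=
  (fun i => fderiv ℝ H (z.2.2.1, z.2.1) (0, Pi.single i 1) + ω * (z.2.1 i - z.2.2.2 i),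
   fun i => -(fderiv ℝ H (z.1, z.2.2.2) (Pi.single i 1, 0)) - ω * (z.1 i - z.2.2.1 i),
   fun i => fderiv ℝ H (z.1, z.2.2.2) (0, Pi.single i 1) + ω * (z.2.2.2 i - z.2.1 i),
   fun i => -(fderiv ℝ H (z.2.2.1, z.2.1) (Pi.single i 1, 0)) - ω * (z.2.2.1 i - z.1 i))

theorem locallyLipschitz_extendedHamiltonianField {n : ℕ} {H : (Fin n → ℝ) × (Fin n → ℝ) → ℝ}
    (hH : LocallyLipschitz (fderiv ℝ H)) (ω : ℝ) :
    LocallyLipschitz (extendedHamiltonianField H ω) := by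
  -- The field is a smooth function of the two differentials of `H` and of the point.
  have hM : ContDiff ℝ 1 (fun w : ((((Fin n → ℝ) × (Fin n → ℝ)) →L[ℝ] ℝ) ×
      (((Fin n → ℝ) × (Fin n → ℝ)) →L[ℝ] ℝ)) ×
      ((Fin n → ℝ) × (Fin n → ℝ) × (Fin n → ℝ) × (Fin n → ℝ)) =>
    ((fun i => w.1.1 (0, Pi.single i 1) + ω * (w.2.2.1 i - w.2.2.2.2 i),
      fun i => -(w.1.2 (Pi.single i 1, 0)) - ω * (w.2.1 i - w.2.2.2.1 i),
      fun i => w.1.2 (0, Pi.single i 1) + ω * (w.2.2.2.2 i - w.2.2.1 i),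
      fun i => -(w.1.1 (Pi.single i 1, 0)) - ω * (w.2.2.2.1 i - w.2.1 i)) :
      (Fin n → ℝ) × (Fin n → ℝ) × (Fin n → ℝ) × (Fin n → ℝ))) := by
    refine .prodMk (contDiff_pi.2 fun i => ?_) <| .prodMk (contDiff_pi.2 fun i => ?_) <|
      .prodMk (contDiff_pi.2 fun i => ?_) (contDiff_pi.2 fun i => ?_) <;> fun_prop
  have hxp : ContDiff ℝ 1 (fun z : (Fin n → ℝ) × (Fin n → ℝ) × (Fin n → ℝ) × (Fin n → ℝ) =>
    (z.2.2.1, z.2.1)) := by fun_prop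
  have hqy : ContDiff ℝ 1 (fun z : (Fin n → ℝ) × (Fin n → ℝ) × (Fin n → ℝ) × (Fin n → ℝ) =>
    (z.1, z.2.2.2)) := by fun_prop
  have hw := ((hH.comp hxp.locallyLipschitz).prodMk (hH.comp hqy.locallyLipschitz)).prodMk .id
  have hcomp := hM.locallyLipschitz.comp hw
  exact hcomp

/-- uniqueness — a solution of the extended system starting from the doubled
initial condition coincides with the solution of the original system on `[0,T]`. -/
theorem extended_hamiltonian_unique_solution
    (n : ℕ) (H : (Fin n → ℝ) × (Fin n → ℝ) → ℝ)
    (hH : ContDiff ℝ 1 H) (hLip : LocallyLipschitz (fun z => fderiv ℝ H z))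
    (ω : ℝ) (T : ℝ) (Q₀ P₀ : Fin n → ℝ)
    (Q P : ℝ → Fin n → ℝ) (q p x y : ℝ → Fin n → ℝ)
    (hQ : ∀ t ∈ Set.Icc (0:ℝ) T, ∀ i, HasDerivAt (fun τ => Q τ i)
      (fderiv ℝ H (Q t, P t) (0, Pi.single i 1)) t)
    (hP : ∀ t ∈ Set.Icc (0:ℝ) T, ∀ i, HasDerivAt (fun τ => P τ i)
      (-(fderiv ℝ H (Q t, P t) (Pi.single i 1, 0))) t)
    (hQ0 : Q 0 = Q₀) (hP0 : P 0 = P₀)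
    (hq : ∀ t ∈ Set.Icc (0:ℝ) T, ∀ i, HasDerivAt (fun τ => q τ i)
      (fderiv ℝ H (x t, p t) (0, Pi.single i 1) + ω * (p t i - y t i)) t)
    (hp : ∀ t ∈ Set.Icc (0:ℝ) T, ∀ i, HasDerivAt (fun τ => p τ i)
      (-(fderiv ℝ H (q t, y t) (Pi.single i 1, 0)) - ω * (q t i - x t i)) t)
    (hx : ∀ t ∈ Set.Icc (0:ℝ) T, ∀ i, HasDerivAt (fun τ => x τ i)
      (fderiv ℝ H (q t, y t) (0, Pi.single i 1) + ω * (y t i - p t i)) t)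
    (hy : ∀ t ∈ Set.Icc (0:ℝ) T, ∀ i, HasDerivAt (fun τ => y τ i)
      (-(fderiv ℝ H (x t, p t) (Pi.single i 1, 0)) - ω * (x t i - q t i)) t)
    (hq0 : q 0 = Q₀) (hx0 : x 0 = Q₀) (hp0 : p 0 = P₀) (hy0 : y 0 = P₀) :
    ∀ t ∈ Set.Icc (0:ℝ) T, q t = Q t ∧ x t = Q t ∧ p t = P t ∧ y t = P t := by
  have hsol : ∀ t ∈ Icc (0:ℝ) T, HasDerivAt (fun τ => (q τ, p τ, x τ, y τ))
      (extendedHamiltonianField H ω (q t, p t, x t, y t)) t := fun t ht =>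
    (hasDerivAt_pi.2 (hq t ht)).prodMk <| (hasDerivAt_pi.2 (hp t ht)).prodMk <|
      (hasDerivAt_pi.2 (hx t ht)).prodMk (hasDerivAt_pi.2 (hy t ht))
  have hdiag : ∀ t ∈ Icc (0:ℝ) T, HasDerivAt (fun τ => (Q τ, P τ, Q τ, P τ))
      (extendedHamiltonianField H ω (Q t, P t, Q t, P t)) t := by
    intro t ht
    have hQt := hasDerivAt_pi.2 (hQ t ht)
    have hPt := hasDerivAt_pi.2 (hP t ht)
    simpa [extendedHamiltonianField] using hQt.prodMk (hPt.prodMk (hQt.prodMk hPt))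
  intro t ht
  have heq := (locallyLipschitz_extendedHamiltonianField hLip ω).eqOn_Icc_of_hasDerivAt
    hsol hdiag (by simp only [hq0, hp0, hx0, hy0, hQ0, hP0]) ht
  simp only [Prod.mk.injEq] at heq
  exact ⟨heq.1, heq.2.2.1, heq.2.1, heq.2.2.2⟩
end

section
/- Fix θ ∈ ℝ and let M : ℝ^{4n} → ℝ^{4n} be the linear map sending (q,p,x,y) to (q',p',x',y') where q' = (q+x)/2 + (cos θ·(q−x) + sin θ·(p−y))/2, p' = (p+y)/2 + (−sin θ·(q−x) + cos θ·(p−y))/2, x' = (q+x)/2 − (cos θ·(q−x) + sin θ·(p−y))/2, y' = (p+y)/2 − (−sin θ·(q−x) + cos θ·(p−y))/2. Then Mᵀ 𝕁 M = 𝕁; that is, the explicit update map φ_{ωH_C}^δ (with θ = 2ωδ) is a linear symplectic map. -/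
open scoped Matrix

/-- the explicit update map `φ_{ωH_C}^δ` (rotation by angle `θ = 2ωδ` of
`(q−x, p−y)` around the fixed mean `((q+x)/2, (p+y)/2)`) is a linear symplectic map:
its matrix `M` satisfies `Mᵀ 𝕁 M = 𝕁`. -/
theorem phiC_is_symplectic
    (n : ℕ) (θ : ℝ)
    (f : (((Fin n ⊕ Fin n) ⊕ (Fin n ⊕ Fin n)) → ℝ) → (((Fin n ⊕ Fin n) ⊕ (Fin n ⊕ Fin n)) → ℝ))
    (hf : f = fun z k =>
      match k with
      | Sum.inl (Sum.inl i) =>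
          (z (Sum.inl (Sum.inl i)) + z (Sum.inr (Sum.inl i))) / 2 +
          (Real.cos θ * (z (Sum.inl (Sum.inl i)) - z (Sum.inr (Sum.inl i))) +
           Real.sin θ * (z (Sum.inl (Sum.inr i)) - z (Sum.inr (Sum.inr i)))) / 2
      | Sum.inl (Sum.inr i) =>
          (z (Sum.inl (Sum.inr i)) + z (Sum.inr (Sum.inr i))) / 2 +
          (-Real.sin θ * (z (Sum.inl (Sum.inl i)) - z (Sum.inr (Sum.inl i))) +
           Real.cos θ * (z (Sum.inl (Sum.inr i)) - z (Sum.inr (Sum.inr i)))) / 2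
      | Sum.inr (Sum.inl i) =>
          (z (Sum.inl (Sum.inl i)) + z (Sum.inr (Sum.inl i))) / 2 -
          (Real.cos θ * (z (Sum.inl (Sum.inl i)) - z (Sum.inr (Sum.inl i))) +
           Real.sin θ * (z (Sum.inl (Sum.inr i)) - z (Sum.inr (Sum.inr i)))) / 2
      | Sum.inr (Sum.inr i) =>
          (z (Sum.inl (Sum.inr i)) + z (Sum.inr (Sum.inr i))) / 2 -
          (-Real.sin θ * (z (Sum.inl (Sum.inl i)) - z (Sum.inr (Sum.inl i))) +
           Real.cos θ * (z (Sum.inl (Sum.inr i)) - z (Sum.inr (Sum.inr i)))) / 2)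
    (M 𝕁 : Matrix ((Fin n ⊕ Fin n) ⊕ (Fin n ⊕ Fin n)) ((Fin n ⊕ Fin n) ⊕ (Fin n ⊕ Fin n)) ℝ)
    (hM : M = Matrix.of (fun i j => f (Pi.single j 1) i))
    (h𝕁 : 𝕁 = Matrix.fromBlocks (Matrix.fromBlocks 0 1 (-1) 0) 0 0 (Matrix.fromBlocks 0 1 (-1) 0)) :
    Mᵀ * 𝕁 * M = 𝕁 := by
  have hblocks : M = Matrix.fromBlocks
      (Matrix.fromBlocks (((1 + Real.cos θ) / 2) • 1) ((Real.sin θ / 2) • 1)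
        ((-Real.sin θ / 2) • 1) (((1 + Real.cos θ) / 2) • 1))
      (Matrix.fromBlocks (((1 - Real.cos θ) / 2) • 1) ((-Real.sin θ / 2) • 1)
        ((Real.sin θ / 2) • 1) (((1 - Real.cos θ) / 2) • 1))
      (Matrix.fromBlocks (((1 - Real.cos θ) / 2) • 1) ((-Real.sin θ / 2) • 1)
        ((Real.sin θ / 2) • 1) (((1 - Real.cos θ) / 2) • 1))
      (Matrix.fromBlocks (((1 + Real.cos θ) / 2) • 1) ((Real.sin θ / 2) • 1)
        ((-Real.sin θ / 2) • 1) (((1 + Real.cos θ) / 2) • 1)) := by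
    subst hM hf
    ext ((i | i) | (i | i)) ((j | j) | (j | j)) <;>
      simp [Matrix.one_apply, Pi.single_apply] <;> split_ifs <;> ring
  have hsq := Real.sin_sq_add_cos_sq θ
  rw [hblocks, h𝕁]
  simp only [Matrix.fromBlocks_transpose, Matrix.fromBlocks_multiply, Matrix.fromBlocks_add,
    Matrix.transpose_smul, Matrix.transpose_one, Matrix.mul_zero,
    Matrix.mul_one, Matrix.mul_neg, add_zero, zero_add,
    Matrix.mul_smul, smul_smul, ← neg_smul, ← add_smul]
  rw [← Matrix.fromBlocks_zero (l := Fin n) (m := Fin n) (n := Fin n) (o := Fin n) (α := ℝ)]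
  congr 2 <;> ext i j <;> by_cases h : i = j <;> simp [Matrix.one_apply, h] <;> linarith
end

section
/- Let H : ℝⁿ × ℝⁿ → ℝ be twice continuously differentiable, ω, δ ∈ ℝ, and define the maps φ_{H_A}^s(q,p,x,y) = (q, p − s·∂_q H(q,y), x + s·∂_y H(q,y), y), φ_{H_B}^s(q,p,x,y) = (q + s·∂_p H(x,p), p, x, y − s·∂_x H(x,p)), and φ_{ωH_C}^s the linear rotation map with angle 2ωs that fixes ((q+x)/2,(p+y)/2) and rotates (q−x, p−y). Then the second-order integrator φ₂^δ := φ_{H_A}^{δ/2} ∘ φ_{H_B}^{δ/2} ∘ φ_{ωH_C}^δ ∘ φ_{H_B}^{δ/2} ∘ φ_{H_A}^{δ/2} is differentiable and at every point its Jacobian matrix M satisfies Mᵀ 𝕁 M = 𝕁, i.e. φ₂^δ is symplectic. -/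
open scoped Matrix

/-- Points `(q, p, x, y)` of `ℝ^{4n}`. -/
abbrev ExtendedPhaseSpace (n : ℕ) : Type := (Fin n ⊕ Fin n) ⊕ (Fin n ⊕ Fin n) → ℝ

namespace ExtendedPhaseSpace

variable {n : ℕ}

/-- The 2-form `dq ∧ dp + dx ∧ dy`. -/
def form (u v : ExtendedPhaseSpace n) : ℝ :=
  ∑ i, (u (.inl (.inl i)) * v (.inl (.inr i)) - u (.inl (.inr i)) * v (.inl (.inl i)) +
    (u (.inr (.inl i)) * v (.inr (.inr i)) - u (.inr (.inr i)) * v (.inr (.inl i))))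

/-- A differentiable map is symplectic if its derivative preserves `form`. -/
def IsSymplectic (f : ExtendedPhaseSpace n → ExtendedPhaseSpace n) : Prop :=
  Differentiable ℝ f ∧ ∀ z u v, form (fderiv ℝ f z u) (fderiv ℝ f z v) = form u v

theorem IsSymplectic.comp {f g : ExtendedPhaseSpace n → ExtendedPhaseSpace n}
    (hf : IsSymplectic f) (hg : IsSymplectic g) : IsSymplectic (f ∘ g) := by
  refine ⟨hf.1.comp hg.1, fun z u v => ?_⟩
  rw [fderiv_comp z (hf.1 (g z)) (hg.1 z)]
  exact (hf.2 _ _ _).trans (hg.2 _ _ _)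

theorem IsSymplectic.of_isLinearMap {f : ExtendedPhaseSpace n → ExtendedPhaseSpace n}
    (hf : IsLinearMap ℝ f) (hform : ∀ u v, form (f u) (f v) = form u v) : IsSymplectic f := by
  have hderiv (z) : HasFDerivAt f (hf.mk' f).toContinuousLinearMap z :=
    (hf.mk' f).toContinuousLinearMap.hasFDerivAt
  refine ⟨fun z => (hderiv z).differentiableAt, fun z u v => ?_⟩
  rw [(hderiv z).fderiv]
  exact hform u v

theorem form_eq_dotProduct (u v : ExtendedPhaseSpace n) :
    form u v = u ⬝ᵥ (Matrix.fromBlocks (Matrix.fromBlocks 0 1 (-1) 0) 0 0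
      (Matrix.fromBlocks 0 1 (-1) 0) : Matrix _ _ ℝ) *ᵥ v := by
  simp [form, dotProduct, Matrix.fromBlocks_mulVec, Fintype.sum_sum_type, Finset.sum_add_distrib,
    Matrix.neg_mulVec, sub_eq_add_neg]

/-- The Jacobian matrix of a symplectic map is a symplectic matrix. -/
theorem IsSymplectic.jacobian {f : ExtendedPhaseSpace n → ExtendedPhaseSpace n}
    (hf : IsSymplectic f) (z : ExtendedPhaseSpace n)
    {M J : Matrix ((Fin n ⊕ Fin n) ⊕ (Fin n ⊕ Fin n)) ((Fin n ⊕ Fin n) ⊕ (Fin n ⊕ Fin n)) ℝ}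
    (hM : M = Matrix.of (fun i j => fderiv ℝ f z (Pi.single j 1) i))
    (hJ : J = Matrix.fromBlocks (Matrix.fromBlocks 0 1 (-1) 0) 0 0
      (Matrix.fromBlocks 0 1 (-1) 0)) :
    Mᵀ * J * M = J := by
  ext i j
  have key := hf.2 z (Pi.single i 1) (Pi.single j 1)
  rw [form_eq_dotProduct, form_eq_dotProduct, ← hJ] at key
  have hcol (k) : fderiv ℝ f z (Pi.single k 1) = fun l => M l k := by
    rw [hM]; rfl
  rw [hcol, hcol, single_one_dotProduct, Matrix.mulVec_single_one] at key
  rw [Matrix.mul_assoc]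
  exact key

/-- The projection `(q, p, x, y) ↦ (q, y)`. -/
def projQY : ExtendedPhaseSpace n →L[ℝ] (Fin n → ℝ) × (Fin n → ℝ) :=
  (ContinuousLinearMap.pi fun i => .proj (.inl (.inl i))).prod
    (ContinuousLinearMap.pi fun i => .proj (.inr (.inr i)))

/-- The shear `(q, p, x, y) ↦ (q, p - s ∂_q H(q, y), x + s ∂_y H(q, y), y)`. -/
noncomputable def shear (H : (Fin n → ℝ) × (Fin n → ℝ) → ℝ) (s : ℝ)
    (z : ExtendedPhaseSpace n) : ExtendedPhaseSpace n :=
  Sum.elim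
    (Sum.elim (fun i => z (.inl (.inl i)))
      (fun i => z (.inl (.inr i)) - s * fderiv ℝ H (projQY z) (Pi.single i 1, 0)))
    (Sum.elim (fun i => z (.inr (.inl i)) + s * fderiv ℝ H (projQY z) (0, Pi.single i 1))
      (fun i => z (.inr (.inr i))))

/-- The derivative of `shear H s` where `H` has second derivative `D`. -/
noncomputable def shearDeriv
    (D : (Fin n → ℝ) × (Fin n → ℝ) →L[ℝ] (Fin n → ℝ) × (Fin n → ℝ) →L[ℝ] ℝ) (s : ℝ) :
    ExtendedPhaseSpace n →L[ℝ] ExtendedPhaseSpace n :=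
  ContinuousLinearMap.pi <| Sum.elim
    (Sum.elim (fun i => .proj (.inl (.inl i)))
      (fun i => .proj (.inl (.inr i)) - s • (D ∘L projQY).flip (Pi.single i 1, 0)))
    (Sum.elim (fun i => .proj (.inr (.inl i)) + s • (D ∘L projQY).flip (0, Pi.single i 1))
      (fun i => .proj (.inr (.inr i))))

theorem hasFDerivAt_shear {H : (Fin n → ℝ) × (Fin n → ℝ) → ℝ} (hH : ContDiff ℝ 2 H) (s : ℝ)
    (z : ExtendedPhaseSpace n) :
    HasFDerivAt (shear H s) (shearDeriv (fderiv ℝ (fderiv ℝ H) (projQY z)) s) z := by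
  have hD : Differentiable ℝ (fderiv ℝ H) :=
    (hH.fderiv_right (m := 1) (by norm_num)).differentiable (by norm_num)
  have hpartial (w) : HasFDerivAt (fun z => fderiv ℝ H (projQY z) w)
      ((fderiv ℝ (fderiv ℝ H) (projQY z) ∘L projQY).flip w) z :=
    (ContinuousLinearMap.apply ℝ ℝ w).hasFDerivAt.comp z
      ((hD (projQY z)).hasFDerivAt.comp z projQY.hasFDerivAt)
  rw [hasFDerivAt_pi']
  rintro ((i | i) | (i | i))
  · exact hasFDerivAt_apply _ z
  · exact (hasFDerivAt_apply _ z).sub ((hpartial _).const_mul s)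
  · exact (hasFDerivAt_apply _ z).add ((hpartial _).const_mul s)
  · exact hasFDerivAt_apply _ z

theorem sum_mul_apply_single (L : (Fin n → ℝ) × (Fin n → ℝ) →L[ℝ] ℝ) (a b : Fin n → ℝ) :
    ∑ i, (a i * L (Pi.single i 1, 0) + b i * L (0, Pi.single i 1)) = L (a, b) := by
  have ha := LinearMap.pi_apply_eq_sum_univ
    (L.toLinearMap ∘ₗ LinearMap.inl ℝ (Fin n → ℝ) (Fin n → ℝ)) a
  have hb := LinearMap.pi_apply_eq_sum_univ
    (L.toLinearMap ∘ₗ LinearMap.inr ℝ (Fin n → ℝ) (Fin n → ℝ)) b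
  have hsingle (i : Fin n) : (fun j => if i = j then (1 : ℝ) else 0) = Pi.single i 1 := by
    ext j; simp [Pi.single_apply, eq_comm]
  simp only [hsingle, LinearMap.comp_apply, LinearMap.inl_apply, LinearMap.inr_apply,
    ContinuousLinearMap.coe_coe, smul_eq_mul] at ha hb
  rw [Finset.sum_add_distrib, ← ha, ← hb, ← map_add]
  simp

theorem form_shearDeriv
    {D : (Fin n → ℝ) × (Fin n → ℝ) →L[ℝ] (Fin n → ℝ) × (Fin n → ℝ) →L[ℝ] ℝ}
    (hD : ∀ a b, D a b = D b a) (s : ℝ) (u v : ExtendedPhaseSpace n) :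
    form (shearDeriv D s u) (shearDeriv D s v) = form u v := by
  have huv := sum_mul_apply_single (D (projQY u)) (projQY v).1 (projQY v).2
  have hvu := sum_mul_apply_single (D (projQY v)) (projQY u).1 (projQY u).2
  have hsymm := hD (projQY u) (projQY v)
  have hdiff : form (shearDeriv D s u) (shearDeriv D s v) - form u v =
      s * (D (projQY u) (projQY v) - D (projQY v) (projQY u)) := by
    rw [← huv, ← hvu, form, form, ← Finset.sum_sub_distrib, ← Finset.sum_sub_distrib,
      Finset.mul_sum]
    refine Finset.sum_congr rfl fun i _ => ?_
    simp [shearDeriv, projQY]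
    ring
  rwa [hsymm, sub_self, mul_zero, sub_eq_zero] at hdiff

theorem isSymplectic_shear {H : (Fin n → ℝ) × (Fin n → ℝ) → ℝ} (hH : ContDiff ℝ 2 H) (s : ℝ) :
    IsSymplectic (shear H s) := by
  refine ⟨fun z => (hasFDerivAt_shear hH s z).differentiableAt, fun z u v => ?_⟩
  rw [(hasFDerivAt_shear hH s z).fderiv]
  exact form_shearDeriv (hH.contDiffAt.isSymmSndFDerivAt (by simp)) s u v

/-- The exchange `(q, p, x, y) ↦ (x, y, q, p)`. -/
def exchange (z : ExtendedPhaseSpace n) : ExtendedPhaseSpace n := fun k => z k.swap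

theorem isSymplectic_exchange : IsSymplectic (exchange (n := n)) := by
  refine .of_isLinearMap ⟨fun _ _ => rfl, fun _ _ => rfl⟩ fun u v => ?_
  exact Finset.sum_congr rfl fun i _ => add_comm _ _

/-- The map fixing `((q + x) / 2, (p + y) / 2)` and acting on `(q - x, p - y)` by the matrix
`!![c, d; -d, c]`. -/
noncomputable def rotation (c d : ℝ) (z : ExtendedPhaseSpace n) : ExtendedPhaseSpace n :=
  Sum.elim
    (Sum.elim
      (fun i => (z (.inl (.inl i)) + z (.inr (.inl i))) / 2 +
        (c * (z (.inl (.inl i)) - z (.inr (.inl i))) +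
          d * (z (.inl (.inr i)) - z (.inr (.inr i)))) / 2)
      (fun i => (z (.inl (.inr i)) + z (.inr (.inr i))) / 2 +
        (-d * (z (.inl (.inl i)) - z (.inr (.inl i))) +
          c * (z (.inl (.inr i)) - z (.inr (.inr i)))) / 2))
    (Sum.elim
      (fun i => (z (.inl (.inl i)) + z (.inr (.inl i))) / 2 -
        (c * (z (.inl (.inl i)) - z (.inr (.inl i))) +
          d * (z (.inl (.inr i)) - z (.inr (.inr i)))) / 2)
      (fun i => (z (.inl (.inr i)) + z (.inr (.inr i))) / 2 -
        (-d * (z (.inl (.inl i)) - z (.inr (.inl i))) +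
          c * (z (.inl (.inr i)) - z (.inr (.inr i)))) / 2))

theorem isSymplectic_rotation {c d : ℝ} (hcd : c ^ 2 + d ^ 2 = 1) :
    IsSymplectic (rotation (n := n) c d) := by
  refine .of_isLinearMap ⟨fun u v => ?_, fun r u => ?_⟩ fun u v => ?_
  · ext ((i | i) | (i | i)) <;>
      simp only [rotation, Sum.elim_inl, Sum.elim_inr, Pi.add_apply] <;> ring
  · ext ((i | i) | (i | i)) <;>
      simp only [rotation, Sum.elim_inl, Sum.elim_inr, Pi.smul_apply, smul_eq_mul] <;> ring
  · refine Finset.sum_congr rfl fun i _ => ?_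
    simp only [rotation, Sum.elim_inl, Sum.elim_inr]
    linear_combination (1 / 2) * ((u (.inl (.inl i)) - u (.inr (.inl i))) *
      (v (.inl (.inr i)) - v (.inr (.inr i))) - (u (.inl (.inr i)) - u (.inr (.inr i))) *
      (v (.inl (.inl i)) - v (.inr (.inl i)))) * hcd

end ExtendedPhaseSpace

/-- the second-order integrator
`φ₂^δ = φ_{H_A}^{δ/2} ∘ φ_{H_B}^{δ/2} ∘ φ_{ωH_C}^δ ∘ φ_{H_B}^{δ/2} ∘ φ_{H_A}^{δ/2}`
is differentiable and its Jacobian `M` satisfies `Mᵀ 𝕁 M = 𝕁` at every point. -/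
theorem strang_composition_is_symplectic
    (n : ℕ) (H : (Fin n → ℝ) × (Fin n → ℝ) → ℝ) (hH : ContDiff ℝ 2 H) (ω δ : ℝ)
    (φA φB φC :
      ℝ → (((Fin n ⊕ Fin n) ⊕ (Fin n ⊕ Fin n)) → ℝ) → (((Fin n ⊕ Fin n) ⊕ (Fin n ⊕ Fin n)) → ℝ))
    (hφA : φA = fun s z k =>
      match k with
      | Sum.inl (Sum.inl i) => z (Sum.inl (Sum.inl i))
      | Sum.inl (Sum.inr i) => z (Sum.inl (Sum.inr i)) -
          s * fderiv ℝ H ((fun j => z (Sum.inl (Sum.inl j))), (fun j => z (Sum.inr (Sum.inr j))))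
            (Pi.single i 1, 0)
      | Sum.inr (Sum.inl i) => z (Sum.inr (Sum.inl i)) +
          s * fderiv ℝ H ((fun j => z (Sum.inl (Sum.inl j))), (fun j => z (Sum.inr (Sum.inr j))))
            (0, Pi.single i 1)
      | Sum.inr (Sum.inr i) => z (Sum.inr (Sum.inr i)))
    (hφB : φB = fun s z k =>
      match k with
      | Sum.inl (Sum.inl i) => z (Sum.inl (Sum.inl i)) +
          s * fderiv ℝ H ((fun j => z (Sum.inr (Sum.inl j))), (fun j => z (Sum.inl (Sum.inr j))))
            (0, Pi.single i 1)
      | Sum.inl (Sum.inr i) => z (Sum.inl (Sum.inr i))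
      | Sum.inr (Sum.inl i) => z (Sum.inr (Sum.inl i))
      | Sum.inr (Sum.inr i) => z (Sum.inr (Sum.inr i)) -
          s * fderiv ℝ H ((fun j => z (Sum.inr (Sum.inl j))), (fun j => z (Sum.inl (Sum.inr j))))
            (Pi.single i 1, 0))
    (hφC : φC = fun s z k =>
      match k with
      | Sum.inl (Sum.inl i) =>
          (z (Sum.inl (Sum.inl i)) + z (Sum.inr (Sum.inl i))) / 2 +
          (Real.cos (2*ω*s) * (z (Sum.inl (Sum.inl i)) - z (Sum.inr (Sum.inl i))) +
           Real.sin (2*ω*s) * (z (Sum.inl (Sum.inr i)) - z (Sum.inr (Sum.inr i)))) / 2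
      | Sum.inl (Sum.inr i) =>
          (z (Sum.inl (Sum.inr i)) + z (Sum.inr (Sum.inr i))) / 2 +
          (-Real.sin (2*ω*s) * (z (Sum.inl (Sum.inl i)) - z (Sum.inr (Sum.inl i))) +
           Real.cos (2*ω*s) * (z (Sum.inl (Sum.inr i)) - z (Sum.inr (Sum.inr i)))) / 2
      | Sum.inr (Sum.inl i) =>
          (z (Sum.inl (Sum.inl i)) + z (Sum.inr (Sum.inl i))) / 2 -
          (Real.cos (2*ω*s) * (z (Sum.inl (Sum.inl i)) - z (Sum.inr (Sum.inl i))) +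
           Real.sin (2*ω*s) * (z (Sum.inl (Sum.inr i)) - z (Sum.inr (Sum.inr i)))) / 2
      | Sum.inr (Sum.inr i) =>
          (z (Sum.inl (Sum.inr i)) + z (Sum.inr (Sum.inr i))) / 2 -
          (-Real.sin (2*ω*s) * (z (Sum.inl (Sum.inl i)) - z (Sum.inr (Sum.inl i))) +
           Real.cos (2*ω*s) * (z (Sum.inl (Sum.inr i)) - z (Sum.inr (Sum.inr i)))) / 2)
    (φ₂ : (((Fin n ⊕ Fin n) ⊕ (Fin n ⊕ Fin n)) → ℝ) → (((Fin n ⊕ Fin n) ⊕ (Fin n ⊕ Fin n)) → ℝ))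
    (hφ₂ : φ₂ = φA (δ/2) ∘ φB (δ/2) ∘ φC δ ∘ φB (δ/2) ∘ φA (δ/2))
    (𝕁 : Matrix ((Fin n ⊕ Fin n) ⊕ (Fin n ⊕ Fin n)) ((Fin n ⊕ Fin n) ⊕ (Fin n ⊕ Fin n)) ℝ)
    (h𝕁 : 𝕁 = Matrix.fromBlocks (Matrix.fromBlocks 0 1 (-1) 0) 0 0 (Matrix.fromBlocks 0 1 (-1) 0)) :
    Differentiable ℝ φ₂ ∧
    ∀ z, ∀ M : Matrix ((Fin n ⊕ Fin n) ⊕ (Fin n ⊕ Fin n)) ((Fin n ⊕ Fin n) ⊕ (Fin n ⊕ Fin n)) ℝ,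
      M = Matrix.of (fun i j => fderiv ℝ φ₂ z (Pi.single j 1) i) →
      Mᵀ * 𝕁 * M = 𝕁 := by
  have hA (s) : φA s = ExtendedPhaseSpace.shear H s := by
    rw [hφA]
    ext z ((i | i) | (i | i)) <;> rfl
  have hB (s) : φB s = ExtendedPhaseSpace.exchange ∘ ExtendedPhaseSpace.shear H s ∘
      ExtendedPhaseSpace.exchange := by
    rw [hφB]
    ext z ((i | i) | (i | i)) <;> rfl
  have hC (s) : φC s =
      ExtendedPhaseSpace.rotation (Real.cos (2 * ω * s)) (Real.sin (2 * ω * s)) := by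
    rw [hφC]
    ext z ((i | i) | (i | i)) <;> rfl
  have hAsymp (s) : ExtendedPhaseSpace.IsSymplectic (φA s) :=
    hA s ▸ ExtendedPhaseSpace.isSymplectic_shear hH s
  have hBsymp (s) : ExtendedPhaseSpace.IsSymplectic (φB s) :=
    hB s ▸ ExtendedPhaseSpace.isSymplectic_exchange.comp
      ((ExtendedPhaseSpace.isSymplectic_shear hH s).comp ExtendedPhaseSpace.isSymplectic_exchange)
  have hCsymp (s) : ExtendedPhaseSpace.IsSymplectic (φC s) :=
    hC s ▸ ExtendedPhaseSpace.isSymplectic_rotation (Real.cos_sq_add_sin_sq _)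
  have hsymp : ExtendedPhaseSpace.IsSymplectic φ₂ :=
    hφ₂ ▸ (hAsymp _).comp ((hBsymp _).comp ((hCsymp _).comp ((hBsymp _).comp (hAsymp _))))
  exact ⟨hsymp.1, fun z M hM => hsymp.jacobian z hM h𝕁⟩
end

section
/- Fix N ≥ 2 and let H : ℝ^N × ℝ^N → ℝ be H(q,p) = (1/4)·Σ_{i=1}^N (q_i² + p_i²)² − Σ_{i=2}^N ( p_{i−1}²·p_i² + q_{i−1}²·q_i² − q_{i−1}²·p_i² − p_{i−1}²·q_i² + 4·p_{i−1}·p_i·q_{i−1}·q_i ). If (q, p) : I → ℝ^N × ℝ^N solves Hamilton's equations q̇_i = ∂H/∂p_i, ṗ_i = −∂H/∂q_i on an interval I, then the total mass I(t) := Σ_{i=1}^N (q_i(t)² + p_i(t)²) is constant on I. -/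
/-- If `F` is homogeneous of degree four along the lines `s ↦ (q - s p, p + s q)`, with factor
`(1 + s²)²`, then its derivative along the infinitesimal rotation `(-p, q)` vanishes. -/
theorem fderiv_rotation_eq_zero {E : Type*} [NormedAddCommGroup E] [NormedSpace ℝ E]
    {F : E × E → ℝ} {q p : E} (hF : DifferentiableAt ℝ F (q, p))
    (hrot : ∀ s : ℝ, F (q - s • p, p + s • q) = (1 + s ^ 2) ^ 2 * F (q, p)) :
    fderiv ℝ F (q, p) (-p, q) = 0 := by
  have hline : HasDerivAt (fun s : ℝ => (q, p) + s • (-p, q)) (-p, q) 0 := by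
    simpa using ((hasDerivAt_id (0 : ℝ)).smul_const (-p, q)).const_add (q, p)
  have hcomp : HasDerivAt (fun s : ℝ => F ((q, p) + s • (-p, q)))
      (fderiv ℝ F (q, p) (-p, q)) 0 :=
    HasFDerivAt.comp_hasDerivAt_of_eq (0 : ℝ) hF.hasFDerivAt hline (by simp)
  have hscale : HasDerivAt (fun s : ℝ => (1 + s ^ 2) ^ 2 * F (q, p)) 0 0 := by
    simpa using ((((hasDerivAt_id (0 : ℝ)).pow 2).const_add 1).pow 2).mul_const (F (q, p))
  refine hcomp.unique (hscale.congr_of_eventuallyEq (.of_forall fun s => ?_))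
  simpa [sub_eq_add_neg] using hrot s

/-- A linear functional on `(Fin N → ℝ) × (Fin N → ℝ)` evaluated through its coordinates. -/
theorem map_prod_eq_sum_single {N : ℕ}
    (L : (Fin N → ℝ) × (Fin N → ℝ) →L[ℝ] ℝ) (x y : Fin N → ℝ) :
    L (x, y) = ∑ i, (x i * L (Pi.single i 1, 0) + y i * L (0, Pi.single i 1)) := by
  have h : (x, y) = ∑ i, (x i • ((Pi.single i 1 : Fin N → ℝ), (0 : Fin N → ℝ)) +
      y i • ((0 : Fin N → ℝ), (Pi.single i 1 : Fin N → ℝ))) := by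
    ext j <;> simp [Prod.fst_sum, Prod.snd_sum, Finset.sum_apply, Pi.single_apply]
  conv_lhs => rw [h]
  simp only [map_sum, map_add, map_smul, smul_eq_mul]

/-- A real function with zero derivative on an order-connected set is constant there. -/
theorem eq_of_hasDerivAt_zero_of_ordConnected {f : ℝ → ℝ} {I : Set ℝ} (hI : I.OrdConnected)
    (hf : ∀ t ∈ I, HasDerivAt f 0 t) {s t : ℝ} (hs : s ∈ I) (ht : t ∈ I) : f s = f t := by
  have h := hI.convex.norm_image_sub_le_of_norm_hasDerivWithin_le (C := 0)
    (fun x hx => (hf x hx).hasDerivWithinAt) (by simp) ht hs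
  simpa [sub_eq_zero] using h

/-- for the finite-dimensional NLS truncation Hamiltonian, the total mass
`Σᵢ (qᵢ² + pᵢ²)` is a first integral of Hamilton's equations. -/
theorem nls_total_mass_conserved
    (N : ℕ) (hN : 2 ≤ N)
    (H : (Fin N → ℝ) → (Fin N → ℝ) → ℝ)
    (hH : H = fun q p =>
      (1/4) * ∑ i : Fin N, (q i ^ 2 + p i ^ 2) ^ 2 -
      ∑ i : Fin (N - 1),
        (p ⟨i.1, by have := i.isLt; omega⟩ ^ 2 * p ⟨i.1 + 1, by have := i.isLt; omega⟩ ^ 2 +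
         q ⟨i.1, by have := i.isLt; omega⟩ ^ 2 * q ⟨i.1 + 1, by have := i.isLt; omega⟩ ^ 2 -
         q ⟨i.1, by have := i.isLt; omega⟩ ^ 2 * p ⟨i.1 + 1, by have := i.isLt; omega⟩ ^ 2 -
         p ⟨i.1, by have := i.isLt; omega⟩ ^ 2 * q ⟨i.1 + 1, by have := i.isLt; omega⟩ ^ 2 +
         4 * p ⟨i.1, by have := i.isLt; omega⟩ * p ⟨i.1 + 1, by have := i.isLt; omega⟩ *
           q ⟨i.1, by have := i.isLt; omega⟩ * q ⟨i.1 + 1, by have := i.isLt; omega⟩))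
    (I : Set ℝ) (hI : I.OrdConnected)
    (q p : ℝ → Fin N → ℝ)
    (hq : ∀ t ∈ I, ∀ i, HasDerivAt (fun τ => q τ i)
      (fderiv ℝ (fun z : (Fin N → ℝ) × (Fin N → ℝ) => H z.1 z.2) (q t, p t)
        (0, Pi.single i 1)) t)
    (hp : ∀ t ∈ I, ∀ i, HasDerivAt (fun τ => p τ i)
      (-(fderiv ℝ (fun z : (Fin N → ℝ) × (Fin N → ℝ) => H z.1 z.2) (q t, p t)
        (Pi.single i 1, 0))) t) :
    ∀ s ∈ I, ∀ t ∈ I,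
      ∑ i : Fin N, (q s i ^ 2 + p s i ^ 2) = ∑ i : Fin N, (q t i ^ 2 + p t i ^ 2) := by
  intro s hs t ht
  refine eq_of_hasDerivAt_zero_of_ordConnected
    (f := fun τ => ∑ i : Fin N, (q τ i ^ 2 + p τ i ^ 2)) hI (fun τ hτ => ?_) hs ht
  have hrot : fderiv ℝ (fun z : (Fin N → ℝ) × (Fin N → ℝ) => H z.1 z.2) (q τ, p τ)
      (-p τ, q τ) = 0 := by
    apply fderiv_rotation_eq_zero
    · subst hH
      fun_prop
    · intro r
      subst hH
      simp only [Pi.add_apply, Pi.sub_apply, Pi.smul_apply, smul_eq_mul, mul_sub,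
        Finset.mul_sum]
      congr 1 <;> refine Finset.sum_congr rfl fun i _ => ?_ <;> ring
  have hderiv := HasDerivAt.fun_sum (u := Finset.univ) fun i _ =>
    ((hq τ hτ i).fun_pow 2).fun_add ((hp τ hτ i).fun_pow 2)
  refine hderiv.congr_deriv ?_
  rw [map_prod_eq_sum_single] at hrot
  rw [← mul_zero (2 : ℝ), ← hrot, Finset.mul_sum]
  refine Finset.sum_congr rfl fun i _ => ?_
  simp only [Pi.neg_apply]
  push_cast
  ring
end
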